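/- If M is an answer set for a ground DLP< program P, then M is a minimal model of P, i.e., M is a model of P and no proper subset of M is a model of P. -/

import Mathlib

/-- A literal: an atom `p` or its strong negation `¬p`. -/
inductive Lit (α : Type) : Type where
  | pos : α → Lit α
  | neg : α → Lit α
deriving DecidableEq

/-- The complementary literal `¬.L`. -/
def Lit.compl {α : Type} : Lit α → Lit α
  | .pos a => .neg a
  | .neg a => .pos a

/-- A ground rule with head, positive body, NAF body, a defeasible/strict marker,
    labelled with the object it belongs to. -/
structure Rule (α κ : Type) : Type where
  head : Set (Lit α)
  bodyPos : Set (Lit α)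
  bodyNeg : Set (Lit α)
  defeasible : Bool
  obj : κ

/-- A ground DLP< program: a finite multiset of object-labelled rules (here: a finite set,
    since rules carry their object label), with nonempty heads, together with a strict
    partial order `<` on objects. -/
structure Program (α κ : Type) : Type where
  rules : Set (Rule α κ)
  lt : κ → κ → Prop
  lt_irrefl : ∀ o, ¬ lt o o
  lt_trans : ∀ a b c, lt a b → lt b c → lt a c
  rules_fin : rules.Finite
  head_ne : ∀ r ∈ rules, r.head.Nonempty

/-- A set of literals is consistent if it contains no complementary pair. -/
def consistent {α : Type} (I : Set (Lit α)) : Prop :=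
  ∀ L ∈ I, Lit.compl L ∉ I

/-- The body of `r` is true in `I`. -/
def bodyTrue {α κ : Type} (I : Set (Lit α)) (r : Rule α κ) : Prop :=
  r.bodyPos ⊆ I ∧ ∀ L ∈ r.bodyNeg, L ∉ I

/-- `r` is satisfied in `I`. -/
def satisfied {α κ : Type} (I : Set (Lit α)) (r : Rule α κ) : Prop :=
  (∃ L ∈ r.head, L ∈ I) ∨ ¬ bodyTrue I r

/-- `r1` overrides `r2` on `L` in `I`. -/
def overridesOn {α κ : Type} (P : Program α κ) (I : Set (Lit α))
    (r1 r2 : Rule α κ) (L : Lit α) : Prop :=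
  Lit.compl L ∈ r1.head ∧ L ∈ r2.head ∧ P.lt r1.obj r2.obj ∧
    r2.defeasible = true ∧ Lit.compl L ∈ I ∧ bodyTrue I r2

/-- `r` is overridden in `I`. -/
def overridden {α κ : Type} (P : Program α κ) (I : Set (Lit α)) (r : Rule α κ) : Prop :=
  ∀ L ∈ r.head, ∃ r1 ∈ P.rules, overridesOn P I r1 r L

/-- `I` is a model of `P`: a consistent set of literals in which every rule is
    satisfied or overridden. -/
def isModel {α κ : Type} (P : Program α κ) (I : Set (Lit α)) : Prop :=
  consistent I ∧ ∀ r ∈ P.rules, satisfied I r ∨ overridden P I r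

/-- A NAF-free ground rule (rules of a reduct, read positively: pos(·) treats
    each strongly negated literal as a fresh atom, which is reflected by placing
    no consistency requirement on models of such rules). -/
structure PosRule (α : Type) : Type where
  head : Set (Lit α)
  body : Set (Lit α)

/-- The reduct G_I(P): delete rules overridden in `I`, delete rules whose NAF body
    clashes with `I`, strip the NAF parts of the remaining rules. -/
def reduct {α κ : Type} (P : Program α κ) (I : Set (Lit α)) : Set (PosRule α) :=
  { s | ∃ r ∈ P.rules, ¬ overridden P I r ∧ (∀ L ∈ r.bodyNeg, L ∉ I) ∧
        s = PosRule.mk r.head r.bodyPos }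

/-- Satisfaction of a NAF-free rule by an arbitrary set of literals (pos-reading). -/
def posSat {α : Type} (I : Set (Lit α)) (s : PosRule α) : Prop :=
  s.body ⊆ I → ∃ L ∈ s.head, L ∈ I

/-- `I` is a model of the positive program `S` (pos-reading: no consistency needed). -/
def posModel {α : Type} (S : Set (PosRule α)) (I : Set (Lit α)) : Prop :=
  ∀ s ∈ S, posSat I s

/-- `M` is a DLP<-answer set of `P`: a model of `P` which is a minimal model of
    pos(G_M(P)). -/
def isAnswerSet {α κ : Type} (P : Program α κ) (M : Set (Lit α)) : Prop :=
  isModel P M ∧ posModel (reduct P M) M ∧ ∀ N, N ⊂ M → ¬ posModel (reduct P M) N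

/-- Overriding is preserved when the interpretation grows, as long as the body of the rule
    stays true. -/
theorem overridden.mono {α κ : Type} {P : Program α κ} {N M : Set (Lit α)} {r : Rule α κ}
    (h : overridden P N r) (hNM : N ⊆ M) (hb : bodyTrue M r) : overridden P M r := by
  intro L hL
  obtain ⟨r1, hr1, h1, h2, h3, h4, h5, -⟩ := h L hL
  exact ⟨r1, hr1, h1, h2, h3, h4, hNM h5, hb⟩

/-- If `M` is an answer set for a ground DLP< program `P`, then `M` is a
    minimal model of `P`: `M` is a model of `P` and no proper subset of `M` is a model. -/
theorem stmt_0 {α κ : Type} (P : Program α κ) (M : Set (Lit α))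
    (h : isAnswerSet P M) :
    isModel P M ∧ ∀ N, N ⊂ M → ¬ isModel P N := by
  refine ⟨h.1, fun N hN hmodel => h.2.2 N hN ?_⟩
  rintro s ⟨r, hr, hover, hneg, rfl⟩ hbody
  rcases hmodel.2 r hr with (hsat | hfalse) | hoverN
  · exact hsat
  · exact absurd ⟨hbody, fun L hL hLN => hneg L hL (hN.subset hLN)⟩ hfalse
  · exact absurd (hoverN.mono hN.subset ⟨hbody.trans hN.subset, hneg⟩) hover
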